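/- Let M be a matrix indexed by a 1-separated set Ξ in a geometrically doubling quasi-metric space, with |M(α,β)| ≤ C exp(−c·d(α,β)) for some c > 0. If M is invertible on ℓ²(Ξ), then there exists c' > 0 such that |M⁻¹(α,β)| ≤ C' exp(−c'·d(α,β)^s) for all α,β, where s = (1 + log₂ A₀)^{-1}. -/

import Mathlib

open scoped ENNReal Classical

/-- `S` is an `r`-separated subset for the quasi-distance `d`. -/
def Separated {X : Type*} (d : X → X → ℝ) (r : ℝ) (S : Set X) : Prop :=
  ∀ a ∈ S, ∀ b ∈ S, a ≠ b → r ≤ d a b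

/-- Geometric doubling with constant `N`. -/
def GeomDoubling {X : Type*} (d : X → X → ℝ) (N : ℕ) : Prop :=
  ∀ (x : X) (r : ℝ) (S : Finset X), (∀ y ∈ S, d x y < r) →
    (∀ a ∈ S, ∀ b ∈ S, a ≠ b → r / 2 < d a b) → S.card ≤ N

/-- Frink's chain inequality: if `ρ x z ≤ 2 max (ρ x y) (ρ y z)`, then the `ρ`-distance between
the endpoints of a chain is controlled by the `ρ`-length of the chain. -/
theorem frink_chain {ι : Type*} {ρ : ι → ι → ℝ} (h0 : ∀ x y, 0 ≤ ρ x y) (hself : ∀ x, ρ x x = 0)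
    (h2 : ∀ x y z, ρ x z ≤ 2 * max (ρ x y) (ρ y z)) (f : ℕ → ι) (i n : ℕ)
    (hn : 0 < n) :
    ρ (f i) (f (i + n + 1)) + 2 * ρ (f i) (f (i + 1)) + 2 * ρ (f (i + n)) (f (i + n + 1)) ≤
      4 * ∑ k ∈ Finset.Ico i (i + n + 1), ρ (f k) (f (k + 1)) := by
  induction n using Nat.strong_induction_on generalizing i with
  | _ n ih =>
  have hfirst := h0 (f i) (f (i + 1))
  have hlast := h0 (f (i + n)) (f (i + n + 1))
  have hsplit : ∀ p, i ≤ p → p ≤ i + n → ∑ k ∈ Finset.Ico i (i + n + 1), ρ (f k) (f (k + 1)) =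
      ∑ k ∈ Finset.Ico i p, ρ (f k) (f (k + 1)) + ρ (f p) (f (p + 1)) +
        ∑ k ∈ Finset.Ico (p + 1) (i + n + 1), ρ (f k) (f (k + 1)) := by
    intro p hip hpn
    rw [← Finset.sum_Ico_succ_top hip, Finset.sum_Ico_consecutive] <;> omega
  have hpos : ∀ a b, 0 ≤ ∑ k ∈ Finset.Ico a b, ρ (f k) (f (k + 1)) :=
    fun a b => Finset.sum_nonneg fun k _ => h0 _ _
  have hends : ρ (f i) (f (i + 1)) + ρ (f (i + n)) (f (i + n + 1)) ≤
      ∑ k ∈ Finset.Ico i (i + n + 1), ρ (f k) (f (k + 1)) := by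
    rw [Finset.sum_Ico_succ_top (by omega), Finset.sum_eq_sum_Ico_succ_bot (by omega)]
    linarith [hpos (i + 1) (i + n)]
  set a := ρ (f i) (f (i + n + 1)) with ha
  rcases (h0 (f i) (f (i + n + 1))).eq_or_lt with hz | hapos
  · linarith
  -- the last index whose distance to the right endpoint is at least `a / 2`
  obtain ⟨p, hpn, hpa, hpmax⟩ : ∃ p ≤ n, a / 2 ≤ ρ (f (i + p)) (f (i + n + 1)) ∧
      ρ (f (i + p + 1)) (f (i + n + 1)) < a / 2 := by
    by_contra! hcon
    have hall : ∀ p, p ≤ n + 1 → a / 2 ≤ ρ (f (i + p)) (f (i + n + 1)) := by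
      intro p
      induction p with
      | zero => intro _; simp only [add_zero]; linarith
      | succ p ihp => intro hp; exact hcon p (by omega) (ihp (by omega))
    have h := hall (n + 1) le_rfl
    rw [← add_assoc, hself] at h
    linarith
  have hleft : a / 2 ≤ ρ (f i) (f (i + p + 1)) := by
    have h := h2 (f i) (f (i + p + 1)) (f (i + n + 1))
    rcases max_cases (ρ (f i) (f (i + p + 1))) (ρ (f (i + p + 1)) (f (i + n + 1))) with
      h' | h' <;> rw [h'.1] at h <;> linarith
  rcases Nat.eq_zero_or_pos p with rfl | hp0
  · simp only [add_zero] at hleft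
    linarith
  rcases hpn.eq_or_lt with rfl | hpn
  · linarith
  have hl := ih p hpn i hp0
  have hr := ih (n - p) (by omega) (i + p) (by omega)
  rw [show i + p + (n - p) = i + n by omega] at hr
  rw [hsplit (i + p) (by omega) (by omega)]
  rw [Finset.sum_Ico_succ_top (by omega)] at hl
  rw [Finset.sum_eq_sum_Ico_succ_bot (by omega)] at hr
  linarith

/-- The chain distance to a fixed point: a function vanishing at `b`, one-sided Lipschitz for `ρ`
and bounded below by `ρ b / 4`. -/
theorem exists_lipschitz_of_le_two_mul_max {ι : Type*} {ρ : ι → ι → ℝ} (h0 : ∀ x y, 0 ≤ ρ x y)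
    (hself : ∀ x, ρ x x = 0) (h2 : ∀ x y z, ρ x z ≤ 2 * max (ρ x y) (ρ y z)) (b : ι) :
    ∃ φ : ι → ℝ, φ b = 0 ∧ (∀ x, 0 ≤ φ x) ∧ (∀ x y, φ y ≤ φ x + ρ x y) ∧
      ∀ x, ρ b x ≤ 4 * φ x := by
  set S : ι → Set ℝ := fun x => {t | ∃ (n : ℕ) (f : ℕ → ι), f 0 = b ∧ f n = x ∧
    ∑ k ∈ Finset.range n, ρ (f k) (f (k + 1)) = t} with hS
  have hSnn : ∀ x, ∀ t ∈ S x, 0 ≤ t := by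
    rintro x t ⟨n, f, -, -, rfl⟩
    exact Finset.sum_nonneg fun k _ => h0 _ _
  have hbdd : ∀ x, BddBelow (S x) := fun x => ⟨0, hSnn x⟩
  have hb : (0 : ℝ) ∈ S b := ⟨0, fun _ => b, rfl, rfl, by simp⟩
  have hext : ∀ x y, ∀ t ∈ S x, t + ρ x y ∈ S y := by
    rintro x y t ⟨n, f, hf0, hfn, rfl⟩
    refine ⟨n + 1, fun k => if k ≤ n then f k else y, by simpa using hf0, by simp, ?_⟩
    rw [Finset.sum_range_succ]
    congr 1
    · refine Finset.sum_congr rfl fun k hk => ?_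
      have hk := Finset.mem_range.1 hk
      simp only [if_pos hk.le, if_pos (show k + 1 ≤ n by omega)]
    · simp [hfn]
  have hne : ∀ x, (S x).Nonempty := fun x => ⟨_, hext b x 0 hb⟩
  refine ⟨fun x => sInf (S x), ?_, fun x => le_csInf (hne x) (hSnn x), fun x y => ?_, fun x => ?_⟩
  · exact le_antisymm (csInf_le (hbdd b) hb) (le_csInf (hne b) (hSnn b))
  · rw [← sub_le_iff_le_add]
    refine le_csInf (hne x) fun t ht => ?_
    linarith [csInf_le (hbdd y) (hext x y t ht)]
  · rw [← div_le_iff₀' (by norm_num)]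
    refine le_csInf (hne x) ?_
    rintro t ⟨n, f, hf0, hfn, rfl⟩
    match n with
    | 0 => simp [← hfn, hf0, hself]
    | 1 =>
      simp only [zero_add, Finset.sum_range_one, hf0, hfn]
      linarith [h0 b x]
    | n + 2 =>
      have h := frink_chain h0 hself h2 f 0 (n + 1) n.succ_pos
      simp only [zero_add, ← Finset.range_eq_Ico, hf0, hfn] at h
      linarith [h0 b (f 1), h0 (f (n + 1)) x]

/-- A finite set contains a `t`-separated subset that is a `t`-net. -/
theorem exists_separated_net {X : Type*} {d : X → X → ℝ} (hself : ∀ x, d x x = 0)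
    (hsymm : ∀ x y, d x y = d y x) {t : ℝ} (ht : 0 ≤ t) (S : Finset X) :
    ∃ F ⊆ S, (∀ a ∈ F, ∀ b ∈ F, a ≠ b → t < d a b) ∧ ∀ y ∈ S, ∃ z ∈ F, d z y ≤ t := by
  induction S using Finset.induction_on with
  | empty => exact ⟨∅, by simp⟩
  | insert a S ha ih =>
    obtain ⟨F, hFS, hsep, hnet⟩ := ih
    by_cases h : ∃ z ∈ F, d z a ≤ t
    · refine ⟨F, hFS.trans (Finset.subset_insert _ _), hsep, fun y hy => ?_⟩
      rcases Finset.mem_insert.1 hy with rfl | hy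
      exacts [h, hnet y hy]
    · push Not at h
      refine ⟨insert a F, Finset.insert_subset_insert _ hFS, fun x hx y hy hxy => ?_,
        fun y hy => ?_⟩
      · rcases Finset.mem_insert.1 hx with rfl | hx' <;>
          rcases Finset.mem_insert.1 hy with rfl | hy'
        · exact absurd rfl hxy
        · rw [hsymm]; exact h y hy'
        · exact h x hx'
        · exact hsep x hx' y hy' hxy
      · rcases Finset.mem_insert.1 hy with rfl | hy
        · exact ⟨y, Finset.mem_insert_self _ _, by rw [hself]; exact ht⟩
        · obtain ⟨z, hz, hzy⟩ := hnet y hy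
          exact ⟨z, Finset.mem_insert_of_mem hz, hzy⟩

/-- Polynomial growth of separated sets in a geometrically doubling space. -/
theorem card_le_pow_of_geomDoubling {X : Type*} {d : X → X → ℝ} {N : ℕ}
    (hself : ∀ x, d x x = 0) (hsymm : ∀ x y, d x y = d y x)
    (hnn : ∀ x y, 0 ≤ d x y) (hdoub : GeomDoubling d N) {Ξ : Set X} (hΞ : Separated d 1 Ξ) (k : ℕ) :
    ∀ (r : ℝ) (x : X) (S : Finset X), r < (3 / 2) ^ k → x ∈ Ξ → (∀ y ∈ S, y ∈ Ξ) →
      (∀ y ∈ S, d x y ≤ r) → S.card ≤ N ^ k := by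
  induction k with
  | zero =>
    intro r x S hr hx hS hball
    have : Nonempty X := ⟨x⟩
    rw [pow_zero, Finset.card_le_one_iff_subset_singleton]
    have hx' : ∀ y ∈ S, y = x := by
      intro y hy
      by_contra hne
      have := hΞ x hx y (hS y hy) (Ne.symm hne)
      linarith [hball y hy]
    exact ⟨x, fun y hy => Finset.mem_singleton.2 (hx' y hy)⟩
  | succ k ih =>
    intro r x S hr hx hS hball
    rcases S.eq_empty_or_nonempty with rfl | ⟨y₀, hy₀⟩
    · simp
    have hr0 : 0 ≤ r := (hnn x y₀).trans (hball y₀ hy₀)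
    rcases hr0.eq_or_lt with hr0 | hr0
    · subst hr0
      rw [pow_succ]
      have hN : 1 ≤ N := by
        simpa using hdoub x 1 {x} (by simp [hself]) (by simp)
      exact (ih 0 x S (by positivity) hx hS hball).trans (Nat.le_mul_of_pos_right _ hN)
    obtain ⟨F, hFS, hsep, hnet⟩ := exists_separated_net hself hsymm
      (t := 2 / 3 * r) (by positivity) S
    have hF : F.card ≤ N := by
      refine hdoub x (4 / 3 * r) F (fun y hy => ?_) fun a ha b hb hab => ?_
      · linarith [hball y (hFS hy)]
      · linarith [hsep a ha b hb hab]
    have hsub : S ⊆ F.biUnion fun z => S.filter fun y => d z y ≤ 2 / 3 * r := by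
      intro y hy
      obtain ⟨z, hz, hzy⟩ := hnet y hy
      exact Finset.mem_biUnion.2 ⟨z, hz, Finset.mem_filter.2 ⟨hy, hzy⟩⟩
    calc S.card ≤ _ := Finset.card_le_card hsub
      _ ≤ F.card * N ^ k := by
        refine Finset.card_biUnion_le_card_mul _ _ _ fun z hz => ?_
        refine ih (2 / 3 * r) z _ ?_ (hS z (hFS hz)) (fun y hy => hS y (Finset.mem_filter.1 hy).1)
          fun y hy => (Finset.mem_filter.1 hy).2
        rw [pow_succ] at hr
        linarith
      _ ≤ N * N ^ k := Nat.mul_le_mul_right _ hF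
      _ = N ^ (k + 1) := by ring

/-- Exponential sums over a separated set are uniformly bounded. -/
theorem exists_sum_exp_le_of_geomDoubling {X : Type*} {d : X → X → ℝ} {N : ℕ}
    (hself : ∀ x, d x x = 0) (hsymm : ∀ x y, d x y = d y x)
    (hnn : ∀ x y, 0 ≤ d x y) (hdoub : GeomDoubling d N) {Ξ : Set X} (hΞ : Separated d 1 Ξ)
    {c : ℝ} (hc : 0 < c) :
    ∃ B, 0 ≤ B ∧ ∀ (x : Ξ) (S : Finset Ξ), ∑ y ∈ S, Real.exp (-(c * d x y)) ≤ B := by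
  obtain ⟨m, hm⟩ := pow_unbounded_of_one_lt (N : ℝ) (show (1 : ℝ) < 3 / 2 by norm_num)
  set Q : ℝ := (3 / 2) ^ m with hQ
  have hQ0 : 0 < Q := by positivity
  set D : ℝ := max 1 (m.factorial * Q / c ^ m) with hD
  have hD0 : 0 ≤ D := le_max_of_le_left zero_le_one
  have hex : ∀ t : ℝ, ∃ k : ℕ, t < (3 / 2) ^ k :=
    fun t => pow_unbounded_of_one_lt t (by norm_num)
  have hdecay : ∀ t : ℝ, 0 ≤ t → Real.exp (-(c * t)) ≤ D * (Q⁻¹) ^ Nat.find (hex t) := by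
    intro t ht
    rcases Nat.eq_zero_or_pos (Nat.find (hex t)) with hk | hk
    · rw [hk, pow_zero, mul_one]
      exact (Real.exp_le_one_iff.2 (by nlinarith)).trans (le_max_left _ _)
    obtain ⟨j, hj⟩ := Nat.exists_eq_add_of_lt hk
    rw [zero_add] at hj
    have hjt : (3 / 2 : ℝ) ^ j ≤ t := not_lt.1 (Nat.find_min (hex t) (m := j) (by omega))
    have ht0 : 0 < t := lt_of_lt_of_le (by positivity) hjt
    rw [hj]
    calc Real.exp (-(c * t)) = (Real.exp (c * t))⁻¹ := Real.exp_neg _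
      _ ≤ ((c * t) ^ m / m.factorial)⁻¹ :=
        inv_anti₀ (by positivity) (Real.pow_div_factorial_le_exp _ (by positivity) m)
      _ ≤ ((c * (3 / 2) ^ j) ^ m / m.factorial)⁻¹ := by
        gcongr
      _ = (m.factorial * Q / c ^ m) * (Q⁻¹) ^ (j + 1) := by
        rw [mul_pow, ← pow_mul, mul_comm j m, pow_mul, ← hQ, inv_pow, pow_succ]
        field_simp
      _ ≤ D * (Q⁻¹) ^ (j + 1) := by
        gcongr
        exact le_max_right _ _
  have hq1 : (N : ℝ) / Q < 1 := (div_lt_one hQ0).2 hm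
  have hsum := summable_geometric_of_lt_one (r := (N : ℝ) / Q) (by positivity) hq1
  refine ⟨D * ∑' k : ℕ, ((N : ℝ) / Q) ^ k, by positivity, fun x S => ?_⟩
  set g : Ξ → ℕ := fun y => Nat.find (hex (d x y)) with hg
  have hfib : ∀ k, ((S.filter fun y => g y = k).card : ℝ) ≤ (N : ℝ) ^ k := by
    intro k
    rcases (S.filter fun y => g y = k).eq_empty_or_nonempty with he | hne
    · rw [he]; simp
    obtain ⟨y₀, hy₀, hmax⟩ := Finset.exists_max_image (S.filter fun y => g y = k)
      (fun y => d x y) hne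
    have h := card_le_pow_of_geomDoubling hself hsymm hnn hdoub hΞ k (d x y₀) x
      ((S.filter fun y => g y = k).map (Function.Embedding.subtype _)) ?_ x.2 ?_ ?_
    · rw [Finset.card_map] at h
      exact_mod_cast h
    · rw [← (Finset.mem_filter.1 hy₀).2]
      exact Nat.find_spec (hex (d x y₀))
    · intro y hy
      obtain ⟨z, -, rfl⟩ := Finset.mem_map.1 hy
      exact z.2
    · intro y hy
      obtain ⟨z, hz, rfl⟩ := Finset.mem_map.1 hy
      exact hmax z hz
  calc ∑ y ∈ S, Real.exp (-(c * d x y)) ≤ ∑ y ∈ S, D * (Q⁻¹) ^ g y :=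
        Finset.sum_le_sum fun y _ => hdecay _ (hnn _ _)
    _ = ∑ k ∈ S.image g, ((S.filter fun y => g y = k).card : ℝ) * (D * (Q⁻¹) ^ k) := by
        rw [Finset.sum_comp (fun k => D * (Q⁻¹) ^ k) g]
        simp [nsmul_eq_mul]
    _ ≤ ∑ k ∈ S.image g, D * ((N : ℝ) / Q) ^ k := by
        refine Finset.sum_le_sum fun k _ => ?_
        calc _ ≤ (N : ℝ) ^ k * (D * (Q⁻¹) ^ k) := by
              exact mul_le_mul_of_nonneg_right (hfib k) (by positivity)
          _ = _ := by rw [div_eq_mul_inv, mul_pow]; ring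
    _ ≤ D * ∑' k : ℕ, ((N : ℝ) / Q) ^ k := by
        rw [← Finset.mul_sum]
        gcongr
        exact hsum.sum_le_tsum _ fun k _ => by positivity

/-- Schur's test on `ℓ²`. -/
theorem lp_norm_le_of_schur {ι : Type*} (g v : lp (fun _ : ι => ℝ) 2) (K : ι → ι → ℝ) {B : ℝ}
    (hB : 0 ≤ B) (hK : ∀ a, HasSum (fun b => K a b * v b) (g a))
    (hrow : ∀ a (s : Finset ι), ∑ b ∈ s, |K a b| ≤ B)
    (hcol : ∀ b (s : Finset ι), ∑ a ∈ s, |K a b| ≤ B) : ‖g‖ ≤ B * ‖v‖ := by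
  have h2 : (0 : ℝ) < (2 : ℝ≥0∞).toReal := by norm_num
  refine lp.norm_le_of_forall_sum_le h2 (by positivity) fun s => ?_
  have hv : ∀ F : Finset ι, ∑ b ∈ F, v b ^ 2 ≤ ‖v‖ ^ 2 := fun F => by
    simpa using lp.sum_rpow_le_norm_rpow h2 v F
  suffices ∑ a ∈ s, g a ^ 2 ≤ (B * ‖v‖) ^ 2 by simpa using this
  have hlim : Filter.Tendsto (fun F : Finset ι => ∑ a ∈ s, (∑ b ∈ F, K a b * v b) ^ 2)
      Filter.atTop (nhds (∑ a ∈ s, g a ^ 2)) :=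
    tendsto_finsetSum s fun a _ => (hK a).pow 2
  refine le_of_tendsto' hlim fun F => ?_
  have hcs : ∀ a, (∑ b ∈ F, K a b * v b) ^ 2 ≤ B * ∑ b ∈ F, |K a b| * v b ^ 2 := by
    intro a
    refine (Finset.sum_sq_le_sum_mul_sum_of_sq_le_mul F (f := fun b => |K a b|)
      (g := fun b => |K a b| * v b ^ 2) (fun _ _ => by positivity) (fun _ _ => by positivity)
      fun b _ => ?_).trans ?_
    · rw [← mul_assoc, ← sq, sq_abs, mul_pow]
    · gcongr
      exact hrow a F
  calc ∑ a ∈ s, (∑ b ∈ F, K a b * v b) ^ 2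
      ≤ ∑ a ∈ s, B * ∑ b ∈ F, |K a b| * v b ^ 2 := Finset.sum_le_sum fun a _ => hcs a
    _ = B * ∑ b ∈ F, (∑ a ∈ s, |K a b|) * v b ^ 2 := by
        rw [← Finset.mul_sum, Finset.sum_comm]
        simp_rw [Finset.sum_mul]
    _ ≤ B * ∑ b ∈ F, B * v b ^ 2 := by
        refine mul_le_mul_of_nonneg_left (Finset.sum_le_sum fun b _ => ?_) hB
        exact mul_le_mul_of_nonneg_right (hcol b s) (sq_nonneg _)
    _ = B ^ 2 * ∑ b ∈ F, v b ^ 2 := by rw [← Finset.mul_sum]; ring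
    _ ≤ B ^ 2 * ‖v‖ ^ 2 := by
        gcongr
        exact hv F
    _ = (B * ‖v‖) ^ 2 := by ring

/-- A bounded operator on `ℓ²` acts by its matrix. -/
theorem lp_hasSum_matrix_apply {ι : Type*} [DecidableEq ι]
    (T : lp (fun _ : ι => ℝ) 2 →L[ℝ] lp (fun _ : ι => ℝ) 2) (f : lp (fun _ : ι => ℝ) 2) (a : ι) :
    HasSum (fun b => T (lp.single 2 b (1 : ℝ)) a * f b) (T f a) := by
  have h := ((lp.hasSum_single (by norm_num) f).mapL T).mapL
    (lp.evalCLM ℝ (fun _ : ι => ℝ) 2 a)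
  refine h.congr_fun fun b => ?_
  have : lp.single 2 b (f b) = f b • lp.single (E := fun _ : ι => ℝ) 2 b (1 : ℝ) := by
    rw [← lp.single_smul, smul_eq_mul, mul_one]
  rw [this, map_smul, map_smul, smul_eq_mul, mul_comm]
  rfl

/-- Commutator estimate with an exponential weight. -/
theorem abs_mul_one_sub_exp_le {c C ε m t x : ℝ} (hc : 0 < c) (hε : 0 ≤ ε) (hεc : ε ≤ c / 4)
    (hm : |m| ≤ C * Real.exp (-(c * t))) (hx : |x| ≤ t) :
    |m * (1 - Real.exp (ε * x))| ≤ 4 * C / c * ε * Real.exp (-(c / 2 * t)) := by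
  have ht : 0 ≤ t := (abs_nonneg x).trans hx
  have hC : 0 ≤ C := nonneg_of_mul_nonneg_left ((abs_nonneg m).trans hm) (Real.exp_pos _)
  have h1 : |1 - Real.exp (ε * x)| ≤ ε * t * Real.exp (c / 4 * t) := by
    have hx' := abs_le.1 hx
    have hle : ε * x ≤ ε * t := by gcongr; exact hx'.2
    have hle' : -(ε * t) ≤ ε * x := by nlinarith
    have het : ε * t ≤ c / 4 * t := by gcongr
    have hE : 1 ≤ Real.exp (c / 4 * t) := Real.one_le_exp (by positivity)
    have hnn : 0 ≤ ε * t := by positivity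
    rw [abs_le]
    constructor
    · have ha : Real.exp (ε * x) ≤ Real.exp (ε * t) := Real.exp_le_exp.2 hle
      have hb : 1 - ε * t ≤ Real.exp (-(ε * t)) := by
        linarith [Real.add_one_le_exp (-(ε * t))]
      have hprod : Real.exp (ε * t) * Real.exp (-(ε * t)) = 1 := by
        rw [← Real.exp_add, add_neg_cancel, Real.exp_zero]
      have hcE : Real.exp (ε * t) ≤ Real.exp (c / 4 * t) := Real.exp_le_exp.2 het
      nlinarith [Real.exp_pos (ε * t)]
    · nlinarith [Real.add_one_le_exp (ε * x)]
  have h2 : t ≤ 4 / c * Real.exp (c / 4 * t) := by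
    have h := Real.add_one_le_exp (c / 4 * t)
    rw [div_mul_eq_mul_div, le_div_iff₀ hc]
    linarith
  rw [abs_mul]
  calc |m| * |1 - Real.exp (ε * x)|
      ≤ (C * Real.exp (-(c * t))) * (ε * (4 / c * Real.exp (c / 4 * t)) * Real.exp (c / 4 * t)) := by
        gcongr
        exact h1.trans (by gcongr)
    _ = 4 * C / c * ε * (Real.exp (-(c * t)) * Real.exp (c / 4 * t) * Real.exp (c / 4 * t)) := by
        ring
    _ = 4 * C / c * ε * Real.exp (-(c / 2 * t)) := by
        rw [← Real.exp_add, ← Real.exp_add]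
        ring_nf

/-- Weighted bound for columns of the inverse: if conjugating the matrix of `T` by the weight `w`
changes it by at most `(2 ‖T⁻¹‖)⁻¹` in Schur norm, then the column of `T⁻¹` at a point where `w = 1`
decays like `w⁻¹`. -/
theorem abs_symm_single_le_of_weight {ι : Type*} [DecidableEq ι]
    (T : lp (fun _ : ι => ℝ) 2 ≃L[ℝ] lp (fun _ : ι => ℝ) 2) (w : ι → ℝ) (hw : ∀ a, 0 < w a)
    {R : ℝ} (hR : ∀ a, w a ≤ R) {b : ι} (hb : w b = 1) {B L : ℝ} (hB : 0 ≤ B)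
    (hL : ∀ f, ‖T.symm f‖ ≤ L * ‖f‖) (hL0 : 0 ≤ L) (hLB : L * B ≤ 1 / 2)
    (hrow : ∀ x (s : Finset ι),
      ∑ y ∈ s, |T (lp.single 2 y (1 : ℝ)) x * (1 - w x / w y)| ≤ B)
    (hcol : ∀ y (s : Finset ι),
      ∑ x ∈ s, |T (lp.single 2 y (1 : ℝ)) x * (1 - w x / w y)| ≤ B) (a : ι) :
    w a * |T.symm (lp.single 2 b (1 : ℝ)) a| ≤ 2 * L := by
  set e : lp (fun _ : ι => ℝ) 2 := lp.single 2 b (1 : ℝ) with he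
  set u := T.symm e with hu
  have hR0 : 0 ≤ R := (hw b).le.trans (hR b)
  have hmem : Memℓp (fun x => w x * u x) 2 := by
    refine Memℓp.mono' ((lp.memℓp u).const_smul R) fun x => ?_
    simp only [Pi.smul_apply, smul_eq_mul, norm_mul, Real.norm_eq_abs, abs_of_pos (hw x),
      abs_of_nonneg hR0]
    gcongr
    exact hR x
  set v : lp (fun _ : ι => ℝ) 2 := ⟨fun x => w x * u x, hmem⟩ with hv
  have hvx : ∀ x, v x = w x * u x := fun x => rfl
  have hTu : T u = e := T.apply_symm_apply e
  have hwe : ∀ x, w x * e x = e x := by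
    intro x
    by_cases hx : x = b
    · rw [hx, hb, one_mul]
    · rw [he, lp.single_apply_ne 2 b _ hx, mul_zero]
  have hsum : ∀ x, HasSum (fun y => (T (lp.single 2 y (1 : ℝ)) x * (1 - w x / w y)) * v y)
      ((T v - e) x) := by
    intro x
    have h1 := lp_hasSum_matrix_apply (T : _ →L[ℝ] _) v x
    have h2 := (lp_hasSum_matrix_apply (T : _ →L[ℝ] _) u x).mul_left (w x)
    have h3 := h1.sub h2
    simp only [ContinuousLinearEquiv.coe_coe, hTu, hwe] at h3
    refine (h3.congr_fun fun y => ?_)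
    rw [hvx]
    have := (hw y).ne'
    field_simp
  have hS := lp_norm_le_of_schur _ v _ hB hsum hrow hcol
  have he1 : ‖e‖ = 1 := by rw [he, lp.norm_single (by norm_num)]; simp
  have hTv : ‖T v‖ ≤ 1 + B * ‖v‖ := by
    calc ‖T v‖ = ‖e + (T v - e)‖ := by rw [add_sub_cancel]
      _ ≤ ‖e‖ + ‖T v - e‖ := norm_add_le _ _
      _ ≤ 1 + B * ‖v‖ := by rw [he1]; gcongr
  have hvn : ‖v‖ ≤ L * (1 + B * ‖v‖) := by
    have h := hL (T v)
    rw [T.symm_apply_apply] at h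
    exact h.trans (by gcongr)
  have hv2 : ‖v‖ ≤ 2 * L := by nlinarith [norm_nonneg v]
  have hva := lp.norm_apply_le_norm (p := 2) (by norm_num) v a
  rw [hvx, norm_mul, Real.norm_eq_abs, Real.norm_eq_abs, abs_of_pos (hw a)] at hva
  exact hva.trans hv2

/-- off-diagonal exponential decay of the inverse of a matrix with
exponentially decaying entries, invertible on `ℓ²(Ξ)`, with exponent
`s = (1 + log₂ A₀)⁻¹`. -/
theorem inverse_matrix_decay {X : Type*} (d : X → X → ℝ) (A : ℝ) (N : ℕ)
    (hA : 1 ≤ A)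
    (hnn : ∀ x y, 0 ≤ d x y)
    (hsymm : ∀ x y, d x y = d y x)
    (hzero : ∀ x y, d x y = 0 ↔ x = y)
    (htri : ∀ x y z, d x y ≤ A * (d x z + d z y))
    (hdoub : GeomDoubling d N)
    (Ξ : Set X) (hΞ : Separated d 1 Ξ)
    (M : Ξ → Ξ → ℝ) (C c : ℝ) (hc : 0 < c)
    (hM : ∀ α β : Ξ, |M α β| ≤ C * Real.exp (-(c * d α β)))
    -- `M` is (the matrix of) an invertible bounded operator on `ℓ²(Ξ)`
    (T : lp (fun _ : Ξ => ℝ) 2 ≃L[ℝ] lp (fun _ : Ξ => ℝ) 2)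
    (hT : ∀ α β : Ξ, (T (lp.single 2 β (1 : ℝ)) : ∀ _ : Ξ, ℝ) α = M α β) :
    ∃ c' > 0, ∃ C' : ℝ, ∀ α β : Ξ,
      |(T.symm (lp.single 2 β (1 : ℝ)) : ∀ _ : Ξ, ℝ) α|
        ≤ C' * Real.exp (-(c' * d α β ^ ((1 + Real.logb 2 A)⁻¹))) := by
  set s : ℝ := (1 + Real.logb 2 A)⁻¹ with hs
  have hlog : 0 ≤ Real.logb 2 A := Real.logb_nonneg (by norm_num) hA
  have hs0 : 0 < s := by positivity
  have hs1 : s ≤ 1 := inv_le_one_of_one_le₀ (by linarith)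
  have hA0 : 0 < A := by linarith
  have h2A : (2 * A) ^ s = 2 := by
    have h : (2 : ℝ) ^ (1 + Real.logb 2 A) = 2 * A := by
      rw [Real.rpow_add (by norm_num), Real.rpow_one,
        Real.rpow_logb (by norm_num) (by norm_num) hA0]
    rw [← h, ← Real.rpow_mul (by norm_num), hs, mul_inv_cancel₀ (by positivity), Real.rpow_one]
  have hself : ∀ x, d x x = 0 := fun x => (hzero x x).2 rfl
  set ρ : Ξ → Ξ → ℝ := fun x y => d x y ^ s with hρ
  have hρ0 : ∀ x y, 0 ≤ ρ x y := fun x y => Real.rpow_nonneg (hnn _ _) _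
  have hρself : ∀ x, ρ x x = 0 := fun x => by
    simp only [hρ, hself, Real.zero_rpow hs0.ne']
  have hρsymm : ∀ x y, ρ x y = ρ y x := fun x y => by simp only [hρ, hsymm x y]
  have hρ2 : ∀ x y z, ρ x z ≤ 2 * max (ρ x y) (ρ y z) := by
    intro x y z
    have hmax : max (ρ x y) (ρ y z) = max (d x y) (d y z) ^ s :=
      ((Real.monotoneOn_rpow_Ici_of_exponent_nonneg hs0.le).map_max (hnn x y) (hnn y z)).symm
    have hm0 : 0 ≤ max (d x y) (d y z) := le_max_of_le_left (hnn _ _)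
    rw [hmax, ← h2A, ← Real.mul_rpow (by positivity) hm0]
    refine Real.rpow_le_rpow (hnn _ _) ((htri x z y).trans ?_) hs0.le
    nlinarith [le_max_left (d x y) (d y z), le_max_right (d x y) (d y z)]
  have hρd : ∀ x y, ρ x y ≤ d x y := by
    intro x y
    by_cases hxy : x = y
    · rw [hxy, hρself, hself]
    · have h1 : 1 ≤ d x y := hΞ x x.2 y y.2 fun h => hxy (Subtype.ext h)
      simpa using Real.rpow_le_rpow_of_exponent_le h1 hs1
  obtain ⟨B, hB0, hB⟩ := exists_sum_exp_le_of_geomDoubling hself hsymm hnn hdoub hΞ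
    (half_pos hc)
  set L : ℝ := ‖(T.symm : lp (fun _ : Ξ => ℝ) 2 →L[ℝ] lp (fun _ : Ξ => ℝ) 2)‖ with hLdef
  have hL0 : 0 ≤ L := norm_nonneg _
  have hL : ∀ f, ‖T.symm f‖ ≤ L * ‖f‖ := fun f =>
    (T.symm : lp (fun _ : Ξ => ℝ) 2 →L[ℝ] lp (fun _ : Ξ => ℝ) 2).le_opNorm f
  set D : ℝ := 4 * |C| / c * B with hD
  have hD0 : 0 ≤ D := by positivity
  set ε : ℝ := min (c / 4) (1 / (2 * (L * D + 1))) with hε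
  have hε0 : 0 < ε := lt_min (by positivity) (by positivity)
  have hεc : ε ≤ c / 4 := min_le_left _ _
  have hεL : L * (D * ε) ≤ 1 / 2 := by
    have h : ε ≤ 1 / (2 * (L * D + 1)) := min_le_right _ _
    rw [le_div_iff₀ (by positivity)] at h
    nlinarith
  have hM' : ∀ α β : Ξ, |M α β| ≤ |C| * Real.exp (-(c * d α β)) := fun α β =>
    (hM α β).trans (by gcongr; exact le_abs_self C)
  refine ⟨ε / 4, by positivity, 2 * L, fun α β => ?_⟩
  obtain ⟨φ, hφβ, hφ0, hφlip, hφρ⟩ := exists_lipschitz_of_le_two_mul_max hρ0 hρself hρ2 β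
  set ψ : Ξ → ℝ := fun x => min (φ x) (φ α) with hψ
  have hψlip : ∀ x y, |ψ x - ψ y| ≤ d x y := by
    intro x y
    refine (abs_min_sub_min_le_max _ _ _ _).trans ?_
    rw [sub_self, abs_zero, max_eq_left (abs_nonneg _)]
    refine le_trans ?_ (hρd x y)
    rw [abs_le]
    constructor
    · linarith [hφlip x y]
    · linarith [hφlip y x, hρsymm x y]
  have hwt : ∀ x y, |T (lp.single 2 y (1 : ℝ)) x *
      (1 - Real.exp (ε * ψ x) / Real.exp (ε * ψ y))| ≤
        4 * |C| / c * ε * Real.exp (-(c / 2 * d x y)) := by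
    intro x y
    rw [hT, ← Real.exp_sub, ← mul_sub]
    exact abs_mul_one_sub_exp_le hc hε0.le hεc (hM' x y) (hψlip x y)
  have hschur : ∀ (x : Ξ) (S : Finset Ξ),
      ∑ y ∈ S, 4 * |C| / c * ε * Real.exp (-(c / 2 * d x y)) ≤ D * ε := by
    intro x S
    rw [← Finset.mul_sum]
    calc _ ≤ 4 * |C| / c * ε * B := by
          gcongr
          exact hB x S
      _ = D * ε := by rw [hD]; ring
  have key := abs_symm_single_le_of_weight T (fun x => Real.exp (ε * ψ x))
    (fun x => Real.exp_pos _) (R := Real.exp (ε * φ α))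
    (fun x => Real.exp_le_exp.2 (mul_le_mul_of_nonneg_left (min_le_right _ _) hε0.le))
    (b := β) (by simp [hψ, hφβ, hφ0]) (B := D * ε) (by positivity) hL hL0 hεL
    (fun x S => (Finset.sum_le_sum fun y _ => hwt x y).trans (hschur x S))
    (fun y S => (Finset.sum_le_sum fun x _ => hwt x y).trans (by
      simpa only [hsymm _ (y : X)] using hschur y S)) α
  have hfinal : Real.exp (ε / 4 * d α β ^ s) ≤ Real.exp (ε * ψ α) := by
    refine Real.exp_le_exp.2 ?_
    have h := hφρ α
    rw [hρsymm] at h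
    have hψα : ψ α = φ α := min_self _
    rw [hψα]
    nlinarith
  rw [Real.exp_neg, ← div_eq_mul_inv, le_div_iff₀ (Real.exp_pos _), mul_comm]
  exact (mul_le_mul_of_nonneg_right hfinal (abs_nonneg _)).trans key
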